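/- (Theorem 4.) Assume K ⊆ L_{m,1} ∥ L_{m,2} ∥ L_{m,k} and that both K and cl(K) are conditionally decomposable with respect to (Σ₁, Σ₂, Σ_k). Define supC_k = supC(P_k(K), L_k, Σ_{k,u}), supC_{i+k} = supC(P_{i+k}(K), L_i ∥ cl(supC_k), Σ_{i+k,u}) for i = 1, 2, and supC'_k = supC(P_k(supC_{1+k}) ∩ P_k(supC_{2+k}), L_k, Σ_{k,u}). If supC_{1+k} and supC'_k are synchronously nonconflicting and supC_{2+k} and supC'_k are synchronously nonconflicting, then supC'_k ∥ supC_{1+k} ∥ supC_{2+k} equals the supremal conditionally controllable sublanguage of K, i.e., the union of all conditionally controllable sublanguages of K. -/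

import Mathlib

namespace CoordControl

variable {α : Type*}

/-- Natural projection onto subalphabet `A`: erase all letters outside `A`. -/
noncomputable def proj (A : Set α) (w : List α) : List α :=
  w.filter fun a => @decide (a ∈ A) (Classical.dec _)

/-- Projection of a language. -/
noncomputable def projL (A : Set α) (L : Set (List α)) : Set (List α) :=
  proj A '' L

/-- A word is over alphabet `A`. -/
def WordOver (A : Set α) (w : List α) : Prop := ∀ a ∈ w, a ∈ A

/-- A language is over alphabet `A`. -/
def LangOver (A : Set α) (L : Set (List α)) : Prop := ∀ w ∈ L, WordOver A w

/-- Synchronous product of `L₁` over `A₁` and `L₂` over `A₂`. -/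
def sync (A₁ A₂ : Set α) (L₁ L₂ : Set (List α)) : Set (List α) :=
  {w | WordOver (A₁ ∪ A₂) w ∧ proj A₁ w ∈ L₁ ∧ proj A₂ w ∈ L₂}

/-- Prefix closure. -/
def cl (L : Set (List α)) : Set (List α) := {w | ∃ u, w ++ u ∈ L}

/-- A language is prefix-closed if it equals its prefix closure. -/
def PrefixClosed (L : Set (List α)) : Prop := L = cl L

/-- `K` is controllable with respect to `L` and the uncontrollable events `U`. -/
def Controllable (K L : Set (List α)) (U : Set α) : Prop :=
  ∀ w ∈ cl K, ∀ a ∈ U, w ++ [a] ∈ L → w ++ [a] ∈ cl K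

/-- Supremal controllable sublanguage of `K` w.r.t. `L` and `U`. -/
def supC (K L : Set (List α)) (U : Set α) : Set (List α) :=
  ⋃₀ {M | M ⊆ K ∧ Controllable M L U}

/-- Infimal prefix-closed controllable superlanguage of `K` w.r.t. `L` and `U`. -/
def infC (K L : Set (List α)) (U : Set α) : Set (List α) :=
  ⋂₀ {M | K ⊆ M ∧ PrefixClosed M ∧ Controllable M L U}

/-- `M` over `A₁` and `N` over `A₂` are synchronously nonconflicting. -/
def Nonconflicting (A₁ A₂ : Set α) (M N : Set (List α)) : Prop :=
  cl (sync A₁ A₂ M N) = sync A₁ A₂ (cl M) (cl N)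

/-- The natural projection onto `A` is an `L`-observer. -/
def Observer (A : Set α) (L : Set (List α)) : Prop :=
  ∀ t ∈ projL A L, ∀ s ∈ cl L, proj A s <+: t →
    ∃ u, s ++ u ∈ L ∧ proj A (s ++ u) = t

/-- The natural projection onto `A` is locally control consistent (LCC) for `L`,
with uncontrollable events `U`. -/
def LCC (A U : Set α) (L : Set (List α)) : Prop :=
  ∀ s ∈ cl L, ∀ σ ∈ U ∩ A,
    (∃ u, WordOver Aᶜ u ∧ s ++ u ++ [σ] ∈ cl L) →
    ∃ u', WordOver (Aᶜ ∩ U) u' ∧ s ++ u' ++ [σ] ∈ cl L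

/-- The coordinator `L_k = P_k(L₁) ∥ P_k(L₂)`. -/
noncomputable def coord (Ek : Set α) (L₁ L₂ : Set (List α)) : Set (List α) :=
  sync Ek Ek (projL Ek L₁) (projL Ek L₂)

/-- `K` is conditionally decomposable w.r.t. `(E₁, E₂, Ek)`. -/
noncomputable def CondDecomposable (E₁ E₂ Ek : Set α) (K : Set (List α)) : Prop :=
  K = sync (E₁ ∪ Ek) (E₂ ∪ Ek) (projL (E₁ ∪ Ek) K) (projL (E₂ ∪ Ek) K)

/-- A pair `(M₁, M₂)` is a solution of Problem 1 for the specification `K`: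
`M₁` is over `E₁ ∪ Ek`, `M₂` over `E₂ ∪ Ek`, `cl Mᵢ ⊆ Lᵢ ∥ L_k`, `cl Mᵢ` is
controllable w.r.t. `Lᵢ ∥ L_k` and `Σ_{i+k,u}`, and `M₁ ∥ M₂ = K`,
`cl M₁ ∥ cl M₂ = cl K`. -/
noncomputable def IsSolution (E₁ E₂ Ek U : Set α) (L₁ L₂ K M₁ M₂ : Set (List α)) : Prop :=
  LangOver (E₁ ∪ Ek) M₁ ∧ LangOver (E₂ ∪ Ek) M₂ ∧
  cl M₁ ⊆ sync E₁ Ek L₁ (coord Ek L₁ L₂) ∧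
  cl M₂ ⊆ sync E₂ Ek L₂ (coord Ek L₁ L₂) ∧
  Controllable (cl M₁) (sync E₁ Ek L₁ (coord Ek L₁ L₂)) ((E₁ ∪ Ek) ∩ U) ∧
  Controllable (cl M₂) (sync E₂ Ek L₂ (coord Ek L₁ L₂)) ((E₂ ∪ Ek) ∩ U) ∧
  sync (E₁ ∪ Ek) (E₂ ∪ Ek) M₁ M₂ = K ∧
  sync (E₁ ∪ Ek) (E₂ ∪ Ek) (cl M₁) (cl M₂) = cl K

/-- `M` is relaxed conditionally controllable w.r.t. plants `L₁`, `L₂` and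
coordinator `Lk`. -/
noncomputable def RelaxedCC (E₁ E₂ Ek U : Set α) (L₁ L₂ Lk M : Set (List α)) : Prop :=
  Controllable (projL (E₁ ∪ Ek) M) (sync E₁ Ek L₁ Lk) ((E₁ ∪ Ek) ∩ U) ∧
  Controllable (projL (E₂ ∪ Ek) M) (sync E₂ Ek L₂ Lk) ((E₂ ∪ Ek) ∩ U)

/-- `M` is conditionally controllable (original framework) w.r.t. plants `L₁`, `L₂`
and coordinator `Lk`. -/
noncomputable def CondControllable (E₁ E₂ Ek U : Set α) (L₁ L₂ Lk M : Set (List α)) : Prop :=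
  Controllable (projL Ek M) Lk (Ek ∩ U) ∧
  Controllable (projL (E₁ ∪ Ek) M) (sync E₁ Ek L₁ (cl (projL Ek M))) ((E₁ ∪ Ek) ∩ U) ∧
  Controllable (projL (E₂ ∪ Ek) M) (sync E₂ Ek L₂ (cl (projL Ek M))) ((E₂ ∪ Ek) ∩ U)

theorem proj_append (A : Set α) (u v : List α) : proj A (u ++ v) = proj A u ++ proj A v := by
  simp [proj]

theorem proj_cons_of_mem {A : Set α} {a : α} (h : a ∈ A) (u : List α) :
    proj A (a :: u) = a :: proj A u := by
  simp [proj, h]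

theorem proj_cons_of_notMem {A : Set α} {a : α} (h : a ∉ A) (u : List α) :
    proj A (a :: u) = proj A u := by
  simp [proj, h]

theorem proj_eq_self {A : Set α} {w : List α} (h : WordOver A w) : proj A w = w := by
  simpa [proj, WordOver] using h

theorem proj_eq_nil {A : Set α} {w : List α} (h : ∀ a ∈ w, a ∉ A) : proj A w = [] := by
  simpa [proj] using h

theorem wordOver_proj (A : Set α) (w : List α) : WordOver A (proj A w) := by
  intro a ha
  simpa [proj] using (List.mem_filter.1 ha).2

theorem WordOver.mono {A B : Set α} (h : A ⊆ B) {w : List α} (hw : WordOver A w) :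
    WordOver B w := fun a ha => h (hw a ha)

theorem proj_proj_of_subset {A B : Set α} (h : B ⊆ A) (w : List α) :
    proj B (proj A w) = proj B w := by
  unfold proj
  rw [List.filter_filter]
  refine List.filter_congr fun a _ => ?_
  by_cases ha : a ∈ B
  · simp [ha, h ha]
  · simp [ha]

theorem projL_projL_of_subset {A B : Set α} (h : B ⊆ A) (L : Set (List α)) :
    projL B (projL A L) = projL B L := by
  simp only [projL, Set.image_image, proj_proj_of_subset h]

theorem langOver_projL (A : Set α) (L : Set (List α)) : LangOver A (projL A L) := by
  rintro _ ⟨w, -, rfl⟩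
  exact wordOver_proj A w

theorem projL_mono (A : Set α) {L M : Set (List α)} (h : L ⊆ M) : projL A L ⊆ projL A M :=
  Set.image_mono h

theorem cl_mono {L M : Set (List α)} (h : L ⊆ M) : cl L ⊆ cl M :=
  fun _ ⟨u, hu⟩ => ⟨u, h hu⟩

theorem proj_mem_cl_projL (A : Set α) {L : Set (List α)} {w : List α} (h : w ∈ cl L) :
    proj A w ∈ cl (projL A L) := by
  obtain ⟨u, hu⟩ := h
  exact ⟨proj A u, _, hu, proj_append A w u⟩

theorem supC_subset (K L : Set (List α)) (U : Set α) : supC K L U ⊆ K :=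
  Set.sUnion_subset fun _ h => h.1

theorem subset_supC {M K L : Set (List α)} {U : Set α} (h : M ⊆ K) (hc : Controllable M L U) :
    M ⊆ supC K L U :=
  Set.subset_sUnion_of_mem (show M ∈ {M | M ⊆ K ∧ Controllable M L U} from ⟨h, hc⟩)

theorem controllable_supC (K L : Set (List α)) (U : Set α) : Controllable (supC K L U) L U := by
  rintro w ⟨u, M, hM, hu⟩ a ha hwa
  exact cl_mono (subset_supC hM.1 hM.2) (hM.2 w ⟨u, hu⟩ a ha hwa)

/-- Two words that agree on the shared letters have a common interleaving. -/
theorem exists_proj_eq_proj_eq {A B : Set α} {u v : List α} (hu : WordOver A u)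
    (hv : WordOver B v) (h : proj B u = proj A v) :
    ∃ w, proj A w = u ∧ proj B w = v := by
  induction u generalizing v with
  | nil => exact ⟨v, h.symm, proj_eq_self hv⟩
  | cons a u ih =>
    have haA : a ∈ A := hu a (by simp)
    have hu' : WordOver A u := fun b hb => hu b (by simp [hb])
    by_cases haB : a ∈ B
    · rw [proj_cons_of_mem haB] at h
      obtain ⟨v₁, v₂, rfl, h₁, -, h₂⟩ := List.filter_eq_cons_iff.1 h.symm
      obtain ⟨w, hwA, hwB⟩ := ih hu' (v := v₂) (fun b hb => hv b (by simp [hb])) h₂.symm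
      refine ⟨v₁ ++ a :: w, ?_, ?_⟩
      · rw [proj_append, proj_cons_of_mem haA, hwA, proj_eq_nil (fun b hb => by simpa using h₁ b hb)]
        rfl
      · rw [proj_append, proj_cons_of_mem haB, hwB, proj_eq_self fun b hb => hv b (by simp [hb])]
    · rw [proj_cons_of_notMem haB] at h
      obtain ⟨w, hwA, hwB⟩ := ih hu' hv h
      exact ⟨a :: w, by rw [proj_cons_of_mem haA, hwA], by rw [proj_cons_of_notMem haB, hwB]⟩

theorem projL_eq_sync {A B C : Set α} (hAB : A ∩ B = C) {N₁ N₂ N S : Set (List α)}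
    (hS : ∀ w, w ∈ S ↔ proj C w ∈ N ∧ proj A w ∈ N₁ ∧ proj B w ∈ N₂)
    (h₂ : LangOver B N₂) (hN : N ⊆ projL C N₂) :
    projL A S = sync A C N₁ N := by
  have hCA : C ⊆ A := hAB ▸ Set.inter_subset_left
  have hCB : C ⊆ B := hAB ▸ Set.inter_subset_right
  have key : ∀ {D E : Set α} {w : List α}, D ∩ E = C → WordOver D w →
      proj E w = proj C w := by
    intro D E w hDE hw
    refine List.filter_congr fun a ha => ?_
    have : a ∈ E ↔ a ∈ C := by rw [← hDE]; exact ⟨fun h => ⟨hw a ha, h⟩, fun h => h.2⟩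
    simp [this]
  ext w
  constructor
  · rintro ⟨s, hs, rfl⟩
    obtain ⟨hk, h1, -⟩ := (hS s).1 hs
    refine ⟨(wordOver_proj A s).mono Set.subset_union_left, ?_, ?_⟩
    · rwa [proj_proj_of_subset subset_rfl]
    · rwa [proj_proj_of_subset hCA]
  · rintro ⟨hw, hw1, hwk⟩
    rw [Set.union_eq_self_of_subset_right hCA] at hw
    obtain ⟨v, hv, hvw⟩ := hN hwk
    obtain ⟨z, hzA, hzB⟩ := exists_proj_eq_proj_eq hw (h₂ v hv)
      (by rw [key hAB hw, key (Set.inter_comm B A ▸ hAB) (h₂ v hv), hvw])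
    refine ⟨z, (hS z).2 ⟨?_, ?_, hzB ▸ hv⟩, hzA⟩
    · rwa [← proj_proj_of_subset hCA, hzA]
    · rwa [hzA, ← proj_eq_self hw]

theorem projL_sync_eq {A C : Set α} {N₁ N : Set (List α)}
    (h₁ : LangOver A N₁) (hN : N ⊆ projL C N₁) :
    projL C (sync A C N₁ N) = N := by
  ext w
  constructor
  · rintro ⟨s, hs, rfl⟩
    exact hs.2.2
  · intro hw
    obtain ⟨u, hu, rfl⟩ := hN hw
    exact ⟨u, ⟨(h₁ u hu).mono Set.subset_union_left, by rwa [proj_eq_self (h₁ u hu)], hw⟩, rfl⟩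

theorem Controllable.sync_of_nonconflicting {E C U : Set α} {L N₁ N N' : Set (List α)}
    (hNN' : N ⊆ N') (hNC : Nonconflicting (E ∪ C) C N₁ N)
    (hc : Controllable N₁ (sync E C L (cl N')) ((E ∪ C) ∩ U)) :
    Controllable (sync (E ∪ C) C N₁ N) (sync E C L (cl N)) ((E ∪ C) ∩ U) := by
  intro w hw a ha hwa
  rw [hNC] at hw ⊢
  have hover : WordOver (E ∪ C) (w ++ [a]) := hwa.1
  have hw' : WordOver (E ∪ C) w := fun b hb => hover b (by simp [hb])
  refine ⟨hover.mono Set.subset_union_left, ?_, hwa.2.2⟩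
  rw [proj_eq_self hover]
  exact hc w (by rw [← proj_eq_self hw']; exact hw.2.1) a ha
    ⟨hwa.1, hwa.2.1, cl_mono hNN' hwa.2.2⟩

theorem Controllable.projL_of_larger_coordinator {E C U : Set α} {L Lk M N : Set (List α)}
    (hk : Controllable (projL C M) Lk (C ∩ U)) (hN : cl N ⊆ Lk)
    (hc : Controllable (projL (E ∪ C) M) (sync E C L (cl (projL C M))) ((E ∪ C) ∩ U)) :
    Controllable (projL (E ∪ C) M) (sync E C L (cl N)) ((E ∪ C) ∩ U) := by
  intro w hw a ha hwa
  refine hc w hw a ha ⟨hwa.1, hwa.2.1, ?_⟩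
  have hCw : proj C w ∈ cl (projL C M) := by
    rw [← projL_projL_of_subset (Set.subset_union_right : C ⊆ E ∪ C)]
    exact proj_mem_cl_projL C hw
  have hwk := hwa.2.2
  rw [proj_append] at hwk ⊢
  by_cases haC : a ∈ C
  · rw [proj_cons_of_mem haC] at hwk ⊢
    exact hk _ hCw a ⟨haC, ha.2⟩ (hN hwk)
  · rw [proj_cons_of_notMem haC]
    simpa [proj] using hCw

/-- Theorem 4: distributed computation of the supremal conditionally controllable
sublanguage in the original framework. -/
theorem thm4_supremal_cond_controllable
    (E₁ E₂ Ek U : Set α)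
    (hUniv : E₁ ∪ E₂ = (Set.univ : Set α))
    (hInter : E₁ ∩ E₂ ⊆ Ek) (hSub : Ek ⊆ E₁ ∪ E₂)
    (L₁ L₂ Lm1 Lm2 : Set (List α))
    (hO1 : LangOver E₁ L₁) (hO2 : LangOver E₂ L₂)
    (hP1 : PrefixClosed L₁) (hP2 : PrefixClosed L₂)
    (hm1 : Lm1 ⊆ L₁) (hm2 : Lm2 ⊆ L₂)
    (hc1 : cl Lm1 = L₁) (hc2 : cl Lm2 = L₂)
    (Lk Lmk : Set (List α))
    (hOk : LangOver Ek Lk) (hPk : PrefixClosed Lk)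
    (hmk : Lmk ⊆ Lk) (hck : cl Lmk = Lk)
    (K : Set (List α))
    (hK : K ⊆ sync (E₁ ∪ E₂) Ek (sync E₁ E₂ Lm1 Lm2) Lmk)
    (hCD : CondDecomposable E₁ E₂ Ek K)
    (hCDcl : CondDecomposable E₁ E₂ Ek (cl K))
    (supCk supC1k supC2k supCk' : Set (List α))
    (hk : supCk = supC (projL Ek K) Lk (Ek ∩ U))
    (h1k : supC1k = supC (projL (E₁ ∪ Ek) K) (sync E₁ Ek L₁ (cl supCk)) ((E₁ ∪ Ek) ∩ U))
    (h2k : supC2k = supC (projL (E₂ ∪ Ek) K) (sync E₂ Ek L₂ (cl supCk)) ((E₂ ∪ Ek) ∩ U))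
    (hk' : supCk' = supC (projL Ek supC1k ∩ projL Ek supC2k) Lk (Ek ∩ U))
    (hNC1 : Nonconflicting (E₁ ∪ Ek) Ek supC1k supCk')
    (hNC2 : Nonconflicting (E₂ ∪ Ek) Ek supC2k supCk') :
    sync Ek ((E₁ ∪ Ek) ∪ (E₂ ∪ Ek)) supCk'
        (sync (E₁ ∪ Ek) (E₂ ∪ Ek) supC1k supC2k) =
      ⋃₀ {M | M ⊆ K ∧ CondControllable E₁ E₂ Ek U L₁ L₂ Lk M} := by
  set A := E₁ ∪ Ek with hA
  set B := E₂ ∪ Ek with hB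
  have hAB : A ∩ B = Ek := by
    rw [hA, hB, ← Set.inter_union_distrib_right, Set.union_eq_self_of_subset_left hInter]
  have hkA : Ek ⊆ A := Set.subset_union_right
  have hkB : Ek ⊆ B := Set.subset_union_right
  have huniv : A ∪ B = Set.univ := by
    rw [Set.eq_univ_iff_forall] at hUniv ⊢
    exact fun x => (hUniv x).imp Or.inl Or.inl
  have hover : ∀ w : List α, WordOver (A ∪ B) w := fun w a _ => huniv ▸ Set.mem_univ a
  have h1sub : supC1k ⊆ projL A K := h1k ▸ supC_subset _ _ _
  have h2sub : supC2k ⊆ projL B K := h2k ▸ supC_subset _ _ _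
  have hk'sub : supCk' ⊆ projL Ek supC1k ∩ projL Ek supC2k := hk' ▸ supC_subset _ _ _
  have hO1k : LangOver A supC1k := fun w hw => langOver_projL A K w (h1sub hw)
  have hO2k : LangOver B supC2k := fun w hw => langOver_projL B K w (h2sub hw)
  have hck' : Controllable supCk' Lk (Ek ∩ U) := hk' ▸ controllable_supC _ _ _
  have hk'k : supCk' ⊆ supCk := by
    rw [hk]
    refine subset_supC (fun w hw => ?_) hck'
    rw [← projL_projL_of_subset hkA]
    exact projL_mono Ek h1sub (hk'sub hw).1
  have hclk : cl supCk ⊆ Lk := by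
    rw [hPk]
    refine cl_mono fun w hw => ?_
    obtain ⟨s, hs, rfl⟩ := supC_subset _ _ _ (hk ▸ hw)
    exact hmk (hK hs).2.2
  have hS : ∀ w, w ∈ sync Ek (A ∪ B) supCk' (sync A B supC1k supC2k) ↔
      proj Ek w ∈ supCk' ∧ proj A w ∈ supC1k ∧ proj B w ∈ supC2k := by
    intro w
    constructor
    · rintro ⟨-, hw, hw'⟩
      rw [proj_eq_self (hover w)] at hw'
      exact ⟨hw, hw'.2⟩
    · rintro ⟨hw, hw'⟩
      refine ⟨(hover w).mono Set.subset_union_right, hw, ?_⟩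
      rw [proj_eq_self (hover w)]
      exact ⟨hover w, hw'⟩
  apply Set.Subset.antisymm
  · have hSA := projL_eq_sync hAB hS hO2k (fun w hw => (hk'sub hw).2)
    have hSB := projL_eq_sync (Set.inter_comm B A ▸ hAB)
      (fun w => (hS w).trans (and_congr_right' and_comm)) hO1k (fun w hw => (hk'sub hw).1)
    have hSk : projL Ek (sync Ek (A ∪ B) supCk' (sync A B supC1k supC2k)) = supCk' := by
      rw [← projL_projL_of_subset hkA, hSA, projL_sync_eq hO1k fun w hw => (hk'sub hw).1]
    refine Set.subset_sUnion_of_mem ⟨fun w hw => ?_, ?_⟩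
    · rw [hCD]
      exact ⟨hover w, h1sub ((hS w).1 hw).2.1, h2sub ((hS w).1 hw).2.2⟩
    · refine ⟨?_, ?_, ?_⟩
      · rwa [hSk]
      · rw [hSk, hSA]
        exact Controllable.sync_of_nonconflicting hk'k hNC1
          (h1k ▸ controllable_supC _ _ _)
      · rw [hSk, hSB]
        exact Controllable.sync_of_nonconflicting hk'k hNC2
          (h2k ▸ controllable_supC _ _ _)
  · rintro w ⟨M, ⟨hMK, hMk, hM1, hM2⟩, hwM⟩
    have hM1k : projL A M ⊆ supC1k := h1k ▸ subset_supC (projL_mono A hMK)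
      (Controllable.projL_of_larger_coordinator hMk hclk hM1)
    have hM2k : projL B M ⊆ supC2k := h2k ▸ subset_supC (projL_mono B hMK)
      (Controllable.projL_of_larger_coordinator hMk hclk hM2)
    have hMk' : projL Ek M ⊆ supCk' := by
      rw [hk']
      refine subset_supC (Set.subset_inter ?_ ?_) hMk
      · rw [← projL_projL_of_subset hkA]
        exact projL_mono Ek hM1k
      · rw [← projL_projL_of_subset hkB]
        exact projL_mono Ek hM2k
    exact (hS w).2 ⟨hMk' ⟨w, hwM, rfl⟩, hM1k ⟨w, hwM, rfl⟩, hM2k ⟨w, hwM, rfl⟩⟩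

end CoordControl
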